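/- Let T² ∈ ℝ with T² ≠ 0, and consider on ℝ² the connection with constant Christoffel symbols Γ_{11}¹ = −1, Γ_{12}² = T², Γ_{21}² = −T², Γ_{22}² = 1, and all other Γ_{ij}^k = 0 (the model M₂⁶(0,T²)). Then a smooth vector field X on ℝ² is an affine Killing vector field for this connection if and only if X lies in the ℝ-linear span of the four vector fields (1,0), (0,1), (0, e^{−x¹−x²}), and (0, e^{−x²}). -/

import Mathlib

open Real

/-- The partial derivative `∂f/∂x^i` of a function on `ℝ²` (points are `Fin 2 → ℝ`). -/
noncomputable def pd (f : (Fin 2 → ℝ) → ℝ) (i : Fin 2) (p : Fin 2 → ℝ) : ℝ :=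
  fderiv ℝ f p (Pi.single i 1)

/-- The affine Killing operator
`K^Γ_{ij}^k(v) = ∂_i∂_j v^k + v^l ∂_l Γ_{ij}^k − Γ_{ij}^l ∂_l v^k + Γ_{il}^k ∂_j v^l + Γ_{lj}^k ∂_i v^l`
(summation over `l`). -/
noncomputable def killingOp (Γ : Fin 2 → Fin 2 → Fin 2 → (Fin 2 → ℝ) → ℝ)
    (v : Fin 2 → (Fin 2 → ℝ) → ℝ) (i j k : Fin 2) (p : Fin 2 → ℝ) : ℝ :=
  pd (fun q => pd (v k) j q) i p
    + (∑ l : Fin 2, v l p * pd (Γ i j k) l p)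
    - (∑ l : Fin 2, Γ i j l p * pd (v k) l p)
    + (∑ l : Fin 2, Γ i l k p * pd (v l) j p)
    + (∑ l : Fin 2, Γ l j k p * pd (v l) i p)

/-- `v` is an affine Killing vector field for the connection `Γ` on `U`:
all eight affine Killing equations hold on `U`. -/
def IsAffineKilling (U : Set (Fin 2 → ℝ))
    (Γ : Fin 2 → Fin 2 → Fin 2 → (Fin 2 → ℝ) → ℝ)
    (v : Fin 2 → (Fin 2 → ℝ) → ℝ) : Prop :=
  ∀ i j k : Fin 2, ∀ p ∈ U, killingOp Γ v i j k p = 0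

lemma pd_add {f g : (Fin 2 → ℝ) → ℝ} (hf : Differentiable ℝ f) (hg : Differentiable ℝ g)
    (i : Fin 2) (p : Fin 2 → ℝ) :
    pd (fun q => f q + g q) i p = pd f i p + pd g i p := by
  simp only [pd]
  rw [fderiv_fun_add (hf p) (hg p)]
  rfl

lemma pd_sub {f g : (Fin 2 → ℝ) → ℝ} (hf : Differentiable ℝ f) (hg : Differentiable ℝ g)
    (i : Fin 2) (p : Fin 2 → ℝ) :
    pd (fun q => f q - g q) i p = pd f i p - pd g i p := by
  simp only [pd]
  rw [fderiv_fun_sub (hf p) (hg p)]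
  rfl

lemma pd_mul {f g : (Fin 2 → ℝ) → ℝ} (hf : Differentiable ℝ f) (hg : Differentiable ℝ g)
    (i : Fin 2) (p : Fin 2 → ℝ) :
    pd (fun q => f q * g q) i p = f p * pd g i p + g p * pd f i p := by
  simp only [pd]
  rw [fderiv_fun_mul (hf p) (hg p)]
  rfl

lemma pd_const (a : ℝ) (i : Fin 2) (p : Fin 2 → ℝ) : pd (fun _ => a) i p = 0 := by
  simp [pd]

lemma differentiable_exp_linear (α β : ℝ) :
    Differentiable ℝ (fun q : Fin 2 → ℝ => Real.exp (α * q 0 + β * q 1)) := by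
  fun_prop

lemma pd_exp_linear (α β : ℝ) (i : Fin 2) (p : Fin 2 → ℝ) :
    pd (fun q => Real.exp (α * q 0 + β * q 1)) i p
      = ![α, β] i * Real.exp (α * p 0 + β * p 1) := by
  have h (j : Fin 2) : HasFDerivAt (fun q : Fin 2 → ℝ => q j)
      (ContinuousLinearMap.proj (R := ℝ) (φ := fun _ : Fin 2 => ℝ) j) p :=
    hasFDerivAt_apply j p
  rw [pd, ((((h 0).const_mul α).fun_add ((h 1).const_mul β)).exp).fderiv]
  fin_cases i <;> simp [mul_comm]

lemma contDiff_pd {f : (Fin 2 → ℝ) → ℝ} (hf : ContDiff ℝ (⊤ : ℕ∞) f) (i : Fin 2) :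
    ContDiff ℝ (⊤ : ℕ∞) (pd f i) :=
  (hf.fderiv_right (m := (⊤ : ℕ∞)) (by simp)).clm_apply contDiff_const

lemma pd_comm {f : (Fin 2 → ℝ) → ℝ} (hf : ContDiff ℝ (⊤ : ℕ∞) f) (i j : Fin 2)
    (p : Fin 2 → ℝ) : pd (pd f i) j p = pd (pd f j) i p := by
  have hd : DifferentiableAt ℝ (fderiv ℝ f) p :=
    (hf.fderiv_right (m := (⊤ : ℕ∞)) (by simp)).differentiable (by simp) p
  have key (a b : Fin 2) :
      pd (pd f a) b p = fderiv ℝ (fderiv ℝ f) p (Pi.single b 1) (Pi.single a 1) := by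
    change fderiv ℝ (fun q => fderiv ℝ f q (Pi.single a 1)) p (Pi.single b 1) = _
    rw [fderiv_clm_apply hd (differentiableAt_const _)]
    simp
  rw [key, key]
  exact (hf.contDiffAt.isSymmSndFDerivAt (by
    simpa using WithTop.coe_le_coe.2 (le_top : (2 : ℕ∞) ≤ ⊤))).eq _ _

lemma eq_const_of_pd_eq_zero {f : (Fin 2 → ℝ) → ℝ} (hf : Differentiable ℝ f)
    (h : ∀ i p, pd f i p = 0) (p : Fin 2 → ℝ) : f p = f 0 := by
  refine is_const_of_fderiv_eq_zero hf (fun q => ?_) p 0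
  refine ContinuousLinearMap.coe_injective (LinearMap.pi_ext' fun i => LinearMap.ext_ring ?_)
  exact h i q

/-- If `∂₁ f = α f` and `∂₂ f = β f` with constants `α`, `β`, then `f` is a multiple of an exponential. -/
lemma eq_mul_exp_of_pd {f : (Fin 2 → ℝ) → ℝ} (hf : Differentiable ℝ f) (α β : ℝ)
    (h0 : ∀ p, pd f 0 p = α * f p) (h1 : ∀ p, pd f 1 p = β * f p) (p : Fin 2 → ℝ) :
    f p = f 0 * Real.exp (α * p 0 + β * p 1) := by
  have hc := eq_const_of_pd_eq_zero (hf.mul (differentiable_exp_linear (-α) (-β)))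
    (fun i q => by
      change pd (fun r => f r * Real.exp (-α * r 0 + -β * r 1)) i q = 0
      rw [pd_mul hf (differentiable_exp_linear _ _), pd_exp_linear]
      fin_cases i
      · simp [h0]; ring
      · simp [h1]; ring) p
  simp only [Pi.mul_apply, Pi.zero_apply, mul_zero, add_zero, Real.exp_zero, mul_one] at hc
  rw [← hc, mul_assoc, ← Real.exp_add]
  ring_nf
  simp

lemma pd_exp_family (b c d : ℝ) (i : Fin 2) :
    pd (fun q => b + c * Real.exp (-q 0 - q 1) + d * Real.exp (-q 1)) i
      = fun p => 0 + (-c) * Real.exp (-p 0 - p 1) + ![0, -d] i * Real.exp (-p 1) := by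
  have e1 (q : Fin 2 → ℝ) : -q 0 - q 1 = (-1) * q 0 + (-1) * q 1 := by ring
  have e2 (q : Fin 2 → ℝ) : -q 1 = 0 * q 0 + (-1) * q 1 := by ring
  funext p
  simp only [e1]
  simp only [e2]
  rw [pd_add (by fun_prop) (by fun_prop), pd_add (by fun_prop) (by fun_prop),
    pd_mul (by fun_prop) (by fun_prop), pd_mul (by fun_prop) (by fun_prop),
    pd_exp_linear, pd_exp_linear, pd_const, pd_const, pd_const]
  fin_cases i <;> simp

/-- The affine Killing equations of the model, written out. -/
lemma isAffineKilling_iff (T2 : ℝ) (v : Fin 2 → (Fin 2 → ℝ) → ℝ) :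
    IsAffineKilling Set.univ
      (fun i j k => fun _ : Fin 2 → ℝ =>
        ![![![(-1 : ℝ), 0], ![0, T2]], ![![0, -T2], ![0, 1]]] i j k) v
    ↔ ∀ p, pd (pd (v 0) 0) 0 p - pd (v 0) 0 p = 0
        ∧ pd (pd (v 1) 0) 0 p + pd (v 1) 0 p = 0
        ∧ pd (pd (v 0) 1) 0 p - (T2 + 1) * pd (v 0) 1 p = 0
        ∧ pd (pd (v 0) 0) 1 p + (T2 - 1) * pd (v 0) 1 p = 0
        ∧ pd (pd (v 1) 1) 0 p + T2 * pd (v 0) 0 p + pd (v 1) 0 p = 0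
        ∧ pd (pd (v 1) 0) 1 p - T2 * pd (v 0) 0 p + pd (v 1) 0 p = 0
        ∧ pd (pd (v 0) 1) 1 p - pd (v 0) 1 p = 0
        ∧ pd (pd (v 1) 1) 1 p + pd (v 1) 1 p = 0 := by
  have eta (k j : Fin 2) : (fun q => pd (v k) j q) = pd (v k) j := rfl
  simp only [IsAffineKilling, killingOp, Fin.forall_fin_two, Fin.sum_univ_two, pd_const, eta,
    Set.mem_univ, true_implies, Matrix.cons_val_zero, Matrix.cons_val_one]
  constructor
  · rintro ⟨⟨⟨h1, h2⟩, h3, h4⟩, ⟨h5, h6⟩, h7, h8⟩ p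
    refine ⟨?_, ?_, ?_, ?_, ?_, ?_, ?_, ?_⟩
    · linear_combination h1 p
    · linear_combination h2 p
    · linear_combination h3 p
    · linear_combination h5 p
    · linear_combination h4 p
    · linear_combination h6 p
    · linear_combination h7 p
    · linear_combination h8 p
  · intro h
    refine ⟨⟨⟨fun p => ?_, fun p => ?_⟩, fun p => ?_, fun p => ?_⟩,
      ⟨fun p => ?_, fun p => ?_⟩, fun p => ?_, fun p => ?_⟩ <;>
    obtain ⟨h1, h2, h3, h5, h4, h6, h7, h8⟩ := h p
    · linear_combination h1
    · linear_combination h2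
    · linear_combination h3
    · linear_combination h4
    · linear_combination h5
    · linear_combination h6
    · linear_combination h7
    · linear_combination h8

theorem stmt6 (T2 : ℝ) (hT : T2 ≠ 0)
    (v : Fin 2 → (Fin 2 → ℝ) → ℝ)
    (hv : ∀ i : Fin 2, ContDiff ℝ (⊤ : ℕ∞) (v i)) :
    IsAffineKilling Set.univ
      (fun i j k => fun _ : Fin 2 → ℝ =>
        ![![![(-1 : ℝ), 0], ![0, T2]], ![![0, -T2], ![0, 1]]] i j k) v
    ↔ ∃ a b c d : ℝ, ∀ p : Fin 2 → ℝ,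
        v 0 p = a
        ∧ v 1 p = b + c * Real.exp (-p 0 - p 1) + d * Real.exp (-p 1) := by
  rw [isAffineKilling_iff]
  constructor
  · intro h
    have diff {f : (Fin 2 → ℝ) → ℝ} (hf : ContDiff ℝ (⊤ : ℕ∞) f) : Differentiable ℝ f :=
      hf.differentiable (by simp)
    have hw (i : Fin 2) : Differentiable ℝ (pd (v 1) i) := diff (contDiff_pd (hv 1) i)
    have u1 (p) : pd (v 0) 1 p = 0 := by
      obtain ⟨-, -, h3, h4, -⟩ := h p
      rw [pd_comm (hv 0) 1 0] at h3
      refine (mul_eq_zero.1 (?_ : T2 * pd (v 0) 1 p = 0)).resolve_left hT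
      linear_combination (h4 - h3) / 2
    have u0 (p) : pd (v 0) 0 p = 0 := by
      obtain ⟨-, -, -, -, h5, h6, -⟩ := h p
      rw [pd_comm (hv 1) 1 0] at h5
      refine (mul_eq_zero.1 (?_ : T2 * pd (v 0) 0 p = 0)).resolve_left hT
      linear_combination (h5 - h6) / 2
    have w00 (p) : pd (pd (v 1) 0) 0 p = -pd (v 1) 0 p := by
      linear_combination (h p).2.1
    have w01 (p) : pd (pd (v 1) 0) 1 p = -pd (v 1) 0 p := by
      linear_combination (h p).2.2.2.2.2.1 + T2 * u0 p
    have w10 (p) : pd (pd (v 1) 1) 0 p = -pd (v 1) 0 p := by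
      rw [pd_comm (hv 1), w01]
    have w11 (p) : pd (pd (v 1) 1) 1 p = -pd (v 1) 1 p := by
      linear_combination (h p).2.2.2.2.2.2.2
    have hconst := eq_const_of_pd_eq_zero (diff (hv 0))
      (Fin.forall_fin_two.2 ⟨u0, u1⟩)
    have hA := eq_mul_exp_of_pd (hw 0) (-1) (-1)
      (fun p => by rw [w00]; ring) (fun p => by rw [w01]; ring)
    have hD := eq_mul_exp_of_pd ((hw 1).fun_sub (hw 0)) 0 (-1)
      (fun p => by rw [pd_sub (hw 1) (hw 0), w00, w10]; ring)
      (fun p => by rw [pd_sub (hw 1) (hw 0), w01, w11]; ring)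
    have hB := eq_const_of_pd_eq_zero ((diff (hv 1)).fun_add (hw 1))
      (Fin.forall_fin_two.2
        ⟨fun p => by rw [pd_add (diff (hv 1)) (hw 1), w10]; ring,
          fun p => by rw [pd_add (diff (hv 1)) (hw 1), w11]; ring⟩)
    refine ⟨v 0 0, v 1 0 + pd (v 1) 1 0, -pd (v 1) 0 0, -(pd (v 1) 1 0 - pd (v 1) 0 0),
      fun p => ⟨hconst p, ?_⟩⟩
    have hAp := hA p
    have hDp := hD p
    rw [show -1 * p 0 + -1 * p 1 = -p 0 - p 1 by ring] at hAp
    rw [show 0 * p 0 + -1 * p 1 = -p 1 by ring] at hDp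
    linear_combination hB p - hAp - hDp
  · rintro ⟨a, b, c, d, h⟩ p
    have hu : v 0 = fun _ => a := funext fun q => (h q).1
    have hw : v 1 = fun q => b + c * Real.exp (-q 0 - q 1) + d * Real.exp (-q 1) :=
      funext fun q => (h q).2
    have hu' (i : Fin 2) : pd (v 0) i = fun _ => 0 := by
      funext q; rw [hu, pd_const]
    simp only [hu', pd_const, hw, pd_exp_family, Matrix.cons_val_zero, Matrix.cons_val_one]
    refine ⟨?_, ?_, ?_, ?_, ?_, ?_, ?_, ?_⟩ <;> ring
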